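/- Associativity of t-contractions: Let ℓ, m ∈ ℕ and n ∈ ℤ₊ with m + n > 1, let f₁ ∈ H_V(1,ℓ), f₂ ∈ H_V(1,m), f₃ ∈ H_V(1,n), and let 1 ≤ i ≤ m + n − 1 and 1 ≤ j ≤ n be integers. Then exactly one of the following three cases holds, and in each case the stated identity of formal series in t₁ and t₂ holds: (1) if i < j then (f₁ ₁*₋ᵢ (f₂ ₁*₋ⱼ f₃)_{t₁})_{t₂} = (f₂ ₁*₋(j+ℓ−1) (f₁ ₁*₋ᵢ f₃)_{t₂})_{t₁}; (2) if j ≤ i < j + m then (f₁ ₁*₋ᵢ (f₂ ₁*₋ⱼ f₃)_{t₁})_{t₂} = ((f₁ ₁*₋(i−j+1) f₂)_{t₂} ₁*₋ⱼ f₃)_{t₁}; (3) if i ≥ j + m then (f₁ ₁*₋ᵢ (f₂ ₁*₋ⱼ f₃)_{t₁})_{t₂} = (f₂ ₁*₋ⱼ (f₁ ₁*₋(i−m+1) f₃)_{t₂})_{t₁}. -/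

import Mathlib

noncomputable section

/-!  Setup for `t`-contractions.

Let `V = ⊕ₖ V₍ₖ₎` be a `ℤ`-graded complex vector space with
`dim V₍ₖ₎ < ∞` for every `k`, with a fixed homogeneous basis
`{e_b}` indexed by a type `B` together with a degree function `deg : B → ℤ`
(the basis vectors of `V₍ₖ₎` are the `e_b` with `deg b = k`, so the finiteness
of the dimensions is the hypothesis that `{b | deg b = k}` is finite for
every `k`).  Working in the coordinates given by this basis and its dual basis:

* an element of the algebraic completion `\overline{V^{⊗n}} = ∏ₘ (V^{⊗n})₍ₘ₎`
  is a coefficient function `(ℕ → B) → ℂ` (only the first `n` entries of a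
  tuple are relevant) whose support in each total degree `M` is finite;
* an element `f ∈ H_V(1,n) = Hom(V, \overline{V^{⊗n}})` is the family of
  coefficient functions `F b` of the values `f(e_b)` on the basis, encoded by
  `F : B → (ℕ → B) → ℂ` satisfying `IsGradedHom deg n F`.
-/

/-- `F : B → (ℕ → B) → ℂ` encodes an element of
`H_V(1,n) = Hom(V, \overline{V^{⊗n}})`: for every basis index `b`, the
coefficient function `F b` depends only on the first `n` entries of a tuple and
has finite support in each total degree `M` (normalized tuples are constant
from position `n` on). -/
def IsGradedHom {B : Type*} (deg : B → ℤ) (n : ℕ) (F : B → (ℕ → B) → ℂ) : Prop :=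
  (∀ (b : B) (s s' : ℕ → B), (∀ j < n, s j = s' j) → F b s = F b s') ∧
  (∀ (b : B) (M : ℤ),
    {s : ℕ → B | (∑ j ∈ Finset.range n, deg (s j)) = M ∧ F b s ≠ 0 ∧
      ∀ j, n ≤ j → s j = s 0}.Finite)

/-- The coefficient of `t^k` of the `t`-contraction `(f ₁*₋ᵢ g)ₜ`, in
coordinates: here `F : B → (ℕ → B) → ℂ` encodes `f ∈ H_V(1,m)` (`m` factors),
`G : (ℕ → B) → ℂ` is the coefficient function of the element `g(v)` of a
completed tensor power into whose `i`-th slot `f` is contracted, and the result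
is the coefficient function of the `t^k`-coefficient of
`∑_{deg b = k} (Id^{⊗(i-1)} ⊗ f(e_b)·⟨e_b^*, −⟩ ⊗ Id^{⊗(n-i)}) g(v) · t^k` :
at a tuple `s`, the slots `0, …, i-2` and the slots from `i+m-1` on are the
untouched slots of `g(v)`, slot `i-1` of `g(v)` is paired against `e_b^*`, and
the `m` slots `i-1, …, i+m-2` of the output carry `f(e_b)`. -/
noncomputable def insertContr {B : Type*} (deg : B → ℤ) (m i : ℕ)
    (F : B → (ℕ → B) → ℂ) (G : (ℕ → B) → ℂ) (k : ℤ) : (ℕ → B) → ℂ :=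
  fun s => ∑ᶠ b : B, if deg b = k then
    G (fun j => if j + 1 < i then s j else if j + 1 = i then b else s (j + m - 1))
      * F b (fun j => s (i - 1 + j))
    else 0

/-- Since the homogeneous components are finite-dimensional, the coefficients of a
`t`-contraction are finite sums over the basis vectors of the given degree. -/
theorem insertContr_eq_sum {B : Type*} {deg : B → ℤ}
    (hdim : ∀ k : ℤ, {b : B | deg b = k}.Finite) (m i : ℕ)
    (F : B → (ℕ → B) → ℂ) (G : (ℕ → B) → ℂ) (k : ℤ) (s : ℕ → B) :
    insertContr deg m i F G k s = ∑ b ∈ (hdim k).toFinset,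
      G (fun j => if j + 1 < i then s j else if j + 1 = i then b else s (j + m - 1))
        * F b (fun j => s (i - 1 + j)) := by
  unfold insertContr
  rw [finsum_eq_sum_of_support_subset (s := (hdim k).toFinset)]
  · refine Finset.sum_congr rfl fun b hb => if_pos ?_
    simpa using hb
  · intro b hb
    by_contra h
    exact hb (if_neg (by simpa using h))

/-- associativity of `t`-contractions: let `ℓ m ∈ ℕ`, `n ∈ ℤ₊`
with `m + n > 1`, let `f₁ ∈ H_V(1,ℓ)`, `f₂ ∈ H_V(1,m)`, `f₃ ∈ H_V(1,n)`
(encoded in coordinates by `F₁, F₂, F₃`), and let `1 ≤ i ≤ m + n - 1` and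
`1 ≤ j ≤ n`.  Then exactly one of the three cases `i < j`, `j ≤ i < j + m`,
`i ≥ j + m` holds (whence the disjunction below; the cases are mutually
exclusive inequalities), and in each case the stated identity of formal series
in `t₁, t₂` holds:

1. `i < j` :  `(f₁ ₁*₋ᵢ (f₂ ₁*₋ⱼ f₃)_{t₁})_{t₂} = (f₂ ₁*₋(j+ℓ-1) (f₁ ₁*₋ᵢ f₃)_{t₂})_{t₁}`;
2. `j ≤ i < j + m` : `(f₁ ₁*₋ᵢ (f₂ ₁*₋ⱼ f₃)_{t₁})_{t₂} = ((f₁ ₁*₋(i-j+1) f₂)_{t₂} ₁*₋ⱼ f₃)_{t₁}`;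
3. `i ≥ j + m` : `(f₁ ₁*₋ᵢ (f₂ ₁*₋ⱼ f₃)_{t₁})_{t₂} = (f₂ ₁*₋ⱼ (f₁ ₁*₋(i-m+1) f₃)_{t₂})_{t₁}`.

The identities are stated on the coefficient of `t₁^{k₁} t₂^{k₂}` of the value
at each basis vector `e_b` of `V`, as coefficient functions evaluated at every
tuple `s`. -/
theorem tContraction_associativity {B : Type*} (deg : B → ℤ)
    (hdim : ∀ k : ℤ, {b : B | deg b = k}.Finite)
    (ℓ m n : ℕ) (hn : 1 ≤ n) (hmn : 1 < m + n)
    (F₁ F₂ F₃ : B → (ℕ → B) → ℂ)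
    (h₁ : IsGradedHom deg ℓ F₁) (h₂ : IsGradedHom deg m F₂) (h₃ : IsGradedHom deg n F₃)
    (i j : ℕ) (hi1 : 1 ≤ i) (hi2 : i ≤ m + n - 1) (hj1 : 1 ≤ j) (hj2 : j ≤ n) :
    (i < j ∨ (j ≤ i ∧ i < j + m) ∨ j + m ≤ i) ∧
    (i < j → ∀ (k₁ k₂ : ℤ) (b : B) (s : ℕ → B),
      insertContr deg ℓ i F₁ (insertContr deg m j F₂ (F₃ b) k₁) k₂ s
        = insertContr deg m (j + ℓ - 1) F₂ (insertContr deg ℓ i F₁ (F₃ b) k₂) k₁ s) ∧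
    ((j ≤ i ∧ i < j + m) → ∀ (k₁ k₂ : ℤ) (b : B) (s : ℕ → B),
      insertContr deg ℓ i F₁ (insertContr deg m j F₂ (F₃ b) k₁) k₂ s
        = insertContr deg (ℓ + m - 1) j
            (fun b' => insertContr deg ℓ (i - j + 1) F₁ (F₂ b') k₂) (F₃ b) k₁ s) ∧
    (j + m ≤ i → ∀ (k₁ k₂ : ℤ) (b : B) (s : ℕ → B),
      insertContr deg ℓ i F₁ (insertContr deg m j F₂ (F₃ b) k₁) k₂ s
        = insertContr deg m j F₂ (insertContr deg ℓ (i - m + 1) F₁ (F₃ b) k₂) k₁ s) := by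
  refine ⟨by omega, ?_, ?_, ?_⟩
  · intro hij k₁ k₂ b s
    simp only [insertContr_eq_sum hdim, Finset.sum_mul]
    rw [Finset.sum_comm]
    refine Finset.sum_congr rfl fun b₂ _ => Finset.sum_congr rfl fun b₁ _ => ?_
    rw [mul_right_comm]
    refine congrArg₂ _ (congrArg₂ _ (congrArg _ ?_) (h₁.1 _ _ _ fun p hp => ?_)) (congrArg _ ?_)
    · funext q
      grind
    · grind
    · funext p
      grind
  · rintro ⟨hji, hij⟩ k₁ k₂ b s
    simp only [insertContr_eq_sum hdim, Finset.sum_mul, Finset.mul_sum]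
    rw [Finset.sum_comm]
    refine Finset.sum_congr rfl fun b₂ _ => Finset.sum_congr rfl fun b₁ _ => ?_
    rw [mul_assoc]
    refine congrArg₂ _ (congrArg _ ?_) (congrArg₂ _ (congrArg _ ?_) (congrArg _ ?_))
    all_goals
      funext q
      grind
  · intro hij k₁ k₂ b s
    simp only [insertContr_eq_sum hdim, Finset.sum_mul]
    rw [Finset.sum_comm]
    refine Finset.sum_congr rfl fun b₂ _ => Finset.sum_congr rfl fun b₁ _ => ?_
    rw [mul_right_comm]
    refine congrArg₂ _ (congrArg₂ _ (congrArg _ ?_) (congrArg _ ?_)) (h₂.1 _ _ _ fun p hp => ?_)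
    · funext q
      grind
    · funext p
      grind
    · grind
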